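/- Let H ≥ 4 be a real number, define s_i := H^{1 − 2^{−i}} for i ≥ 0, and define the integer sequence t_0 := 1, t_i := ⌈√(H·t_{i−1})⌉ for i ≥ 1. Then (a) for every i ≥ 1, s_i ≤ t_i ≤ 2·s_i; and (b) with L := ⌊log₂ log₂ H⌋, one has H/4 < t_L ≤ H. -/

import Mathlib

open Real

/-- Let `H ≥ 4`, `s_i := H^{1 − 2^{−i}}`, and let `t : ℕ → ℕ` be the
integer schedule `t_0 = 1`, `t_i = ⌈√(H·t_{i−1})⌉`.  Then
(a) for every `i ≥ 1`, `s_i ≤ t_i ≤ 2 s_i`; and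
(b) with `L := ⌊log₂ log₂ H⌋`, one has `H/4 < t_L ≤ H`. -/
theorem stmt18_schedule_bounds (H : ℝ) (hH : 4 ≤ H) (t : ℕ → ℕ)
    (ht0 : t 0 = 1)
    (ht : ∀ i : ℕ, 1 ≤ i → t i = ⌈Real.sqrt (H * t (i - 1))⌉₊) :
    (∀ i : ℕ, 1 ≤ i →
      H ^ ((1 : ℝ) - 2⁻¹ ^ i) ≤ (t i : ℝ) ∧ (t i : ℝ) ≤ 2 * H ^ ((1 : ℝ) - 2⁻¹ ^ i)) ∧
    (H / 4 < (t ⌊Real.logb 2 (Real.logb 2 H)⌋₊ : ℝ) ∧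
      (t ⌊Real.logb 2 (Real.logb 2 H)⌋₊ : ℝ) ≤ H) := by
  have hH0 : (0 : ℝ) < H := by linarith
  have key : ∀ i : ℕ, H ^ ((1 : ℝ) - 2⁻¹ ^ i) ≤ (t i : ℝ) ∧
      (t i : ℝ) ≤ 2 * H ^ ((1 : ℝ) - 2⁻¹ ^ i) := by
    intro i
    induction i with
    | zero => simp [ht0]
    | succ i ih =>
      obtain ⟨h1, h2⟩ := ih
      have hpos : 0 < H ^ ((1 : ℝ) - 2⁻¹ ^ (i + 1)) := Real.rpow_pos_of_pos hH0 _
      have hsq : (H ^ ((1 : ℝ) - 2⁻¹ ^ (i + 1))) ^ 2 = H * H ^ ((1 : ℝ) - 2⁻¹ ^ i) := by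
        rw [sq, ← Real.rpow_add hH0, ← Real.rpow_one_add' hH0.le]
        · congr 1
          rw [pow_succ]
          ring
        · have : (2⁻¹ : ℝ) ^ i ≤ 1 := pow_le_one₀ (by norm_num) (by norm_num)
          linarith
      have hge1 : 1 ≤ H ^ ((1 : ℝ) - 2⁻¹ ^ i) := by
        apply Real.one_le_rpow (by linarith)
        have : (2⁻¹ : ℝ) ^ i ≤ 1 := pow_le_one₀ (by norm_num) (by norm_num)
        linarith
      rw [ht (i + 1) (by omega), Nat.add_sub_cancel]
      generalize H ^ ((1 : ℝ) - 2⁻¹ ^ (i + 1)) = y at *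
      generalize H ^ ((1 : ℝ) - 2⁻¹ ^ i) = x at *
      have hy2 : 2 ≤ y := by nlinarith
      constructor
      · refine le_trans ?_ (Nat.le_ceil _)
        apply Real.le_sqrt_of_sq_le
        rw [hsq]
        gcongr
      · have hc := Nat.ceil_lt_add_one (Real.sqrt_nonneg (H * (t i : ℝ)))
        have : Real.sqrt (H * (t i : ℝ)) ≤ 3 / 2 * y := by
          apply Real.sqrt_le_iff.mpr
          constructor
          · linarith
          · have := mul_le_mul_of_nonneg_left h2 hH0.le
            nlinarith
        linarith
  refine ⟨fun i _ => key i, ?_⟩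
  have hl2 : 2 ≤ Real.logb 2 H := by
    rw [Real.le_logb_iff_rpow_le (by norm_num) hH0]
    norm_num
    exact hH
  have hl0 : 0 < Real.logb 2 H := by linarith
  have hll : 0 ≤ Real.logb 2 (Real.logb 2 H) := Real.logb_nonneg (by norm_num) (by linarith)
  have hf1 := Nat.floor_le hll
  have hf2 := Nat.lt_floor_add_one (Real.logb 2 (Real.logb 2 H))
  generalize ⌊Real.logb 2 (Real.logb 2 H)⌋₊ = L at *
  rw [Real.le_logb_iff_rpow_le (by norm_num) hl0, Real.rpow_natCast] at hf1
  rw [Real.logb_lt_iff_lt_rpow (by norm_num) hl0, ← Nat.cast_add_one, Real.rpow_natCast,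
    pow_succ] at hf2
  obtain ⟨h1, h2⟩ := key L
  have hp : (0 : ℝ) < 2 ^ L := by positivity
  have ha : H ^ ((2⁻¹ : ℝ) ^ L) = 2 ^ (Real.logb 2 H / 2 ^ L) := by
    conv_lhs => rw [← Real.rpow_logb (b := 2) (by norm_num) (by norm_num) hH0]
    rw [← Real.rpow_mul (by norm_num), inv_pow, div_eq_mul_inv]
  have ha1 : 2 ≤ H ^ ((2⁻¹ : ℝ) ^ L) := by
    rw [ha]
    have := Real.rpow_le_rpow_of_exponent_le (x := 2) (by norm_num) ((one_le_div hp).mpr hf1)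
    simpa using this
  have ha2 : H ^ ((2⁻¹ : ℝ) ^ L) < 4 := by
    rw [ha]
    have h : Real.logb 2 H / 2 ^ L < 2 := by
      rw [div_lt_iff₀ hp]
      linarith
    have := Real.rpow_lt_rpow_of_exponent_lt (x := 2) (by norm_num) h
    norm_num at this
    exact this
  have hm : H ^ ((1 : ℝ) - 2⁻¹ ^ L) * H ^ ((2⁻¹ : ℝ) ^ L) = H := by
    rw [← Real.rpow_add hH0]
    simp
  have hpos : 0 < H ^ ((1 : ℝ) - 2⁻¹ ^ L) := Real.rpow_pos_of_pos hH0 _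
  constructor
  · nlinarith
  · nlinarith
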